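/- Let A be a real von Neumann regular poring and let B and C be two real closures * of A. Then B and C are A-isomorphic (as porings) if and only if for every x ∈ Spec A there exist y ∈ Spec B and z ∈ Spec C with y ∩ A = z ∩ A = x such that the real closed fields B/y and C/z are (A/x)-isomorphic. -/

import Mathlib

universe u

/-- A partial ordering (positive cone) of a commutative ring: closed under addition and
multiplication, contains all squares, and intersects its negative only in `0`. -/
def IsPartialOrdering {A : Type*} [CommRing A] (P : Set A) : Prop :=
  (∀ a ∈ P, ∀ b ∈ P, a + b ∈ P) ∧ (∀ a ∈ P, ∀ b ∈ P, a * b ∈ P) ∧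
  (∀ a : A, a ^ 2 ∈ P) ∧ (∀ a ∈ P, -a ∈ P → a = 0)

/-- A (formally) real ring: a sum of squares vanishes only if each term vanishes. -/
def IsRealRing (A : Type*) [CommRing A] : Prop :=
  ∀ (n : ℕ) (f : Fin n → A), (∑ i, f i ^ 2) = 0 → ∀ i, f i = 0

/-- A von Neumann regular commutative ring. -/
def IsVonNeumannRegular (A : Type*) [CommRing A] : Prop :=
  ∀ a : A, ∃ b : A, a = a ^ 2 * b

/-- A Baer ring: the annihilator of every subset is generated by an idempotent. -/
def IsBaerRing (A : Type*) [CommRing A] : Prop :=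
  ∀ S : Set A, ∃ e : A, e * e = e ∧ ∀ x : A, (∀ s ∈ S, x * s = 0) ↔ ∃ y : A, x = e * y

/-- An essential (ring) extension: an injective ring homomorphism such that every nonzero
ideal of the codomain meets the image of the domain nontrivially. -/
def IsEssentialExtension {A B : Type*} [CommRing A] [CommRing B] (f : A →+* B) : Prop :=
  Function.Injective f ∧ ∀ J : Ideal B, J ≠ ⊥ → ∃ a : A, f a ∈ J ∧ f a ≠ 0

/-- A real ring is real closed * if it admits no proper essential integral extension
which is again a real ring. -/
def IsRealClosedStar (B : Type u) [CommRing B] : Prop :=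
  IsRealRing B ∧ ∀ (C : Type u) [CommRing C] (f : B →+* C),
    IsRealRing C → IsEssentialExtension f → f.IsIntegral → Function.Surjective f

/-- `(B, Q)` together with the embedding `f` is a real closure * of the poring `(A, P)`:
`B` is a real closed * ring, an essential and integral extension of `A`, whose partial
ordering `Q` extends `P`. -/
structure IsRealClosureStarOf (A : Type u) [CommRing A] (P : Set A)
    (B : Type u) [CommRing B] (Q : Set B) (f : A →+* B) : Prop where
  pos_partial : IsPartialOrdering Q
  rcs : IsRealClosedStar B
  essential : IsEssentialExtension f
  integral : f.IsIntegral
  mono : ∀ a ∈ P, f a ∈ Q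

/-- Bundled real closure * of a poring `(A, P)`. -/
structure RealClosureStar (A : Type u) [CommRing A] (P : Set A) : Type (u + 1) where
  carrier : Type u
  [ring : CommRing carrier]
  pos : Set carrier
  emb : A →+* carrier
  is : IsRealClosureStarOf A P carrier pos emb

attribute [instance] RealClosureStar.ring

/-- Two real closures * of `(A, P)` are `A`-isomorphic: there is a ring isomorphism over
`A` preserving the partial orderings in both directions. -/
def RealClosureStar.AIso {A : Type u} [CommRing A] {P : Set A}
    (B C : RealClosureStar A P) : Prop :=
  ∃ e : B.carrier ≃+* C.carrier, (∀ a : A, e (B.emb a) = C.emb a) ∧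
    ∀ b : B.carrier, b ∈ B.pos ↔ e b ∈ C.pos

/-- A poring `(A, P)` has a unique real closure *: one exists, and any two are
`A`-isomorphic as porings. -/
def HasUniqueRealClosureStar (A : Type u) [CommRing A] (P : Set A) : Prop :=
  Nonempty (RealClosureStar A P) ∧ ∀ B C : RealClosureStar A P, B.AIso C

/-- A prime cone of a commutative ring. -/
structure PrimeCone (A : Type u) [CommRing A] : Type u where
  carrier : Set A
  add_mem : ∀ a ∈ carrier, ∀ b ∈ carrier, a + b ∈ carrier
  mul_mem : ∀ a ∈ carrier, ∀ b ∈ carrier, a * b ∈ carrier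
  sq_mem : ∀ a : A, a ^ 2 ∈ carrier
  mem_or_neg_mem : ∀ a : A, a ∈ carrier ∨ -a ∈ carrier
  support : Ideal A
  mem_support : ∀ a : A, a ∈ support ↔ a ∈ carrier ∧ -a ∈ carrier
  support_isPrime : support.IsPrime

/-- The real spectrum of a poring `(A, P)`: the prime cones containing `P`. -/
def RealSpectrum (A : Type u) [CommRing A] (P : Set A) : Type u :=
  {α : PrimeCone A // P ⊆ α.carrier}

/-- A real closed field: formally real, every element or its negative is a square, and
every polynomial of odd degree has a root. -/
def IsRealClosedField (F : Type u) [Field F] : Prop :=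
  IsRealRing F ∧ (∀ x : F, (∃ y : F, y ^ 2 = x) ∨ ∃ y : F, y ^ 2 = -x) ∧
    ∀ p : Polynomial F, Odd p.natDegree → ∃ x : F, Polynomial.eval x p = 0

/-- A total ordering (positive cone) of a ring. -/
def IsTotalOrderingCone {K : Type*} [CommRing K] (T : Set K) : Prop :=
  (∀ a ∈ T, ∀ b ∈ T, a + b ∈ T) ∧ (∀ a ∈ T, ∀ b ∈ T, a * b ∈ T) ∧
  (∀ x : K, x ∈ T ∨ -x ∈ T) ∧ ∀ x ∈ T, -x ∈ T → x = 0

theorem isRealRing_of_injective {R S : Type*} [CommRing R] [CommRing S] (h : R →+* S)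
    (hinj : Function.Injective h) (hS : IsRealRing S) : IsRealRing R := by
  intro n v hv i
  apply hinj
  rw [map_zero]
  exact hS n (fun j => h (v j)) (by simp only [← map_pow, ← map_sum, hv, map_zero]) i

theorem IsRealRing.pi {ι : Type*} {R : ι → Type*} [∀ i, CommRing (R i)]
    (hR : ∀ i, IsRealRing (R i)) : IsRealRing (∀ i, R i) := by
  intro n v hv i
  funext j
  refine hR j n (fun k => v k j) ?_ i
  simpa using congrFun hv j

theorem IsRealRing.eq_zero_of_sq_eq_zero {R : Type*} [CommRing R] (hR : IsRealRing R) {a : R}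
    (ha : a ^ 2 = 0) : a = 0 :=
  hR 1 (fun _ => a) (by simpa using ha) 0

theorem IsRealRing.isReduced {R : Type*} [CommRing R] (hR : IsRealRing R) : IsReduced R :=
  isReduced_iff_pow_one_lt 2 one_lt_two |>.2 fun _ => hR.eq_zero_of_sq_eq_zero

theorem IsVonNeumannRegular.isMaximal_of_isPrime {R : Type*} [CommRing R]
    (hR : IsVonNeumannRegular R) (p : Ideal R) [hp : p.IsPrime] : p.IsMaximal := by
  rw [Ideal.isMaximal_iff]
  refine ⟨fun h => hp.ne_top ((Ideal.eq_top_iff_one p).2 h), fun J a hJ ha haJ => ?_⟩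
  obtain ⟨b, hb⟩ := hR a
  have h0 : a * (1 - a * b) ∈ p := by
    have : a * (1 - a * b) = 0 := by linear_combination hb
    rw [this]
    exact p.zero_mem
  have h1 : 1 - a * b ∈ J := hJ ((hp.mem_or_mem h0).resolve_left ha)
  simpa using J.add_mem h1 (J.mul_mem_right b haJ)

theorem isVonNeumannRegular_of_isReduced {R : Type*} [CommRing R] [IsReduced R]
    (hR : ∀ p : Ideal R, p.IsPrime → p.IsMaximal) : IsVonNeumannRegular R := by
  intro d
  let S : Submonoid R :=
    { carrier := {t | ∃ (n : ℕ) (c : R), t = d ^ n * (1 - d * c)}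
      one_mem' := ⟨0, 0, by simp⟩
      mul_mem' := by
        rintro _ _ ⟨n, c, rfl⟩ ⟨m, c', rfl⟩
        exact ⟨n + m, c + c' - d * c * c', by ring⟩ }
  have h0 : (0 : R) ∈ S := by
    by_contra h0
    obtain ⟨p, hp, -, hpS⟩ := Ideal.exists_le_prime_disjoint (⊥ : Ideal R) S
      (Set.disjoint_left.2 fun t ht htS => h0 (by rwa [← Ideal.mem_bot.1 ht]))
    have hd : d ∉ p := fun hd => Set.disjoint_left.1 hpS hd ⟨1, 0, by simp⟩
    obtain ⟨c, hc⟩ := (hR p hp).exists_inv hd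
    obtain ⟨i, hi, hci⟩ := hc
    have : 1 - d * c ∈ p := by
      have : 1 - d * c = i := by linear_combination -hci
      rwa [this]
    exact Set.disjoint_left.1 hpS this ⟨0, c, by simp⟩
  obtain ⟨n, c, hnc⟩ := h0
  refine ⟨c, ?_⟩
  have : IsNilpotent (d * (1 - d * c)) := by
    refine ⟨n + 1, ?_⟩
    rw [mul_pow, pow_succ d, pow_succ', mul_mul_mul_comm, ← hnc, zero_mul]
  linear_combination this.eq_zero

theorem IsVonNeumannRegular.of_isIntegral {R S : Type*} [CommRing R] [CommRing S]
    (hR : IsVonNeumannRegular R) (h : R →+* S) (hint : h.IsIntegral) [IsReduced S] :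
    IsVonNeumannRegular S := by
  refine isVonNeumannRegular_of_isReduced fun p hp => ?_
  have := hR.isMaximal_of_isPrime (p.comap h)
  exact Ideal.isMaximal_of_isIntegral_of_isMaximal_comap' h hint p this

theorem IsRealRing.quotient {R : Type*} [CommRing R] (hR : IsRealRing R)
    (hvnr : IsVonNeumannRegular R) (J : Ideal R) : IsRealRing (R ⧸ J) := by
  intro n v hv i
  choose w hw using fun j => Ideal.Quotient.mk_surjective (v j)
  obtain ⟨b, hb⟩ := hvnr (∑ j, w j ^ 2)
  have hs : ∑ j, w j ^ 2 ∈ J := by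
    rw [← Ideal.Quotient.eq_zero_iff_mem, ← hv]
    simp [hw]
  set s := ∑ j, w j ^ 2 with hs_def
  have h0 : (1 - s * b) * w i = 0 := by
    refine hR n (fun j => (1 - s * b) * w j) ?_ i
    simp only [mul_pow, ← Finset.mul_sum, ← hs_def]
    linear_combination (1 - s * b) * hb
  rw [← hw i, Ideal.Quotient.eq_zero_iff_mem]
  have : w i = s * (b * w i) := by linear_combination h0
  rw [this]
  exact J.mul_mem_right _ hs

theorem exists_ideal_isEssentialExtension {R S : Type*} [CommRing R] [CommRing S] (h : R →+* S)
    (hinj : Function.Injective h) :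
    ∃ J : Ideal S, IsEssentialExtension ((Ideal.Quotient.mk J).comp h) := by
  obtain ⟨J, -, hJ⟩ := zorn_le_nonempty₀ {J : Ideal S | ∀ a, h a ∈ J → a = 0} (by
    intro c hc hchain K hK
    refine ⟨sSup c, fun a ha => ?_, fun _ => le_sSup⟩
    obtain ⟨L, hL, haL⟩ := (Submodule.mem_sSup_of_directed ⟨K, hK⟩ hchain.directedOn).1 ha
    exact hc hL a haL) ⊥ fun a ha => (map_eq_zero_iff h hinj).1 ha
  have hinj' : Function.Injective ((Ideal.Quotient.mk J).comp h) :=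
    (injective_iff_map_eq_zero _).2 fun a ha => hJ.prop a (Ideal.Quotient.eq_zero_iff_mem.1 ha)
  refine ⟨J, hinj', fun K hK => ?_⟩
  have hle : J ≤ K.comap (Ideal.Quotient.mk J) := fun s hs => by
    rw [Ideal.mem_comap, Ideal.Quotient.eq_zero_iff_mem.2 hs]
    exact K.zero_mem
  by_contra! hcon
  refine hK ((Submodule.eq_bot_iff _).2 fun k hk => ?_)
  obtain ⟨s, rfl⟩ := Ideal.Quotient.mk_surjective k
  refine Ideal.Quotient.eq_zero_iff_mem.2 (hJ.le_of_ge (fun a ha => ?_) hle hk)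
  exact (map_eq_zero_iff _ hinj').1 (hcon a ha)

/-- A real closed * extension which is essential over `R` maps bijectively onto any real
essential integral extension of `R` that receives it. -/
theorem IsRealClosedStar.bijective_of_comp {R : Type*} {B D : Type u} [CommRing R] [CommRing B]
    [CommRing D] (hB : IsRealClosedStar B) (hD : IsRealRing D) (f : R →+* B) (φ : B →+* D)
    (hf : IsEssentialExtension f) (hess : IsEssentialExtension (φ.comp f))
    (hint : (φ.comp f).IsIntegral) : Function.Bijective φ := by
  have hφ : Function.Injective φ := by
    rw [RingHom.injective_iff_ker_eq_bot]
    by_contra hker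
    obtain ⟨a, ha, ha0⟩ := hf.2 _ hker
    exact ha0 (by rw [hess.1 (a₁ := a) (a₂ := 0) (by simpa using ha), map_zero])
  refine ⟨hφ, hB.2 D φ hD ⟨hφ, fun J hJ => ?_⟩ (RingHom.IsIntegral.tower_top f φ hint)⟩
  obtain ⟨a, ha, ha0⟩ := hess.2 J hJ
  exact ⟨f a, ha, ha0⟩

theorem isEssentialExtension_id (R : Type*) [CommRing R] :
    IsEssentialExtension (RingHom.id R) :=
  ⟨Function.injective_id, fun _ hJ => Submodule.exists_mem_ne_zero_of_ne_bot hJ⟩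

theorem isIntegral_mk_comp {R S : Type*} [CommRing R] [CommRing S] (h : R →+* S)
    (hint : h.IsIntegral) (J : Ideal S) : ((Ideal.Quotient.mk J).comp h).IsIntegral :=
  hint.trans _ _ (RingHom.isIntegral_of_surjective _ Ideal.Quotient.mk_surjective)

theorem IsPartialOrdering.sum_sq_mem {B ι : Type*} [CommRing B] {Q : Set B}
    (hQ : IsPartialOrdering Q) (s : Finset ι) (v : ι → B) : ∑ j ∈ s, v j ^ 2 ∈ Q :=
  Finset.sum_induction _ (· ∈ Q) (fun a b ha hb => hQ.1 a ha b hb)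
    (by simpa using hQ.2.2.1 0) fun j _ => hQ.2.2.1 (v j)

/-- A nonnegative element `b` of a poring has a square root in some real integral extension. -/
theorem IsPartialOrdering.exists_real_integral_sqrt {B : Type u} [CommRing B] {Q : Set B}
    (hQ : IsPartialOrdering Q) (hreal : IsRealRing B) {b : B} (hb : b ∈ Q) :
    ∃ (D : Type u) (_ : CommRing D) (h : B →+* D) (s : D),
      IsRealRing D ∧ Function.Injective h ∧ h.IsIntegral ∧ s ^ 2 = h b := by
  let I : Ideal (QuadraticAlgebra B b 0) :=
    { carrier := {t | t.re = 0 ∧ b * t.im = 0}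
      add_mem' := by
        rintro t t' ⟨h₁, h₂⟩ ⟨h₁', h₂'⟩
        exact ⟨by simp [h₁, h₁'], by simp [mul_add, h₂, h₂']⟩
      zero_mem' := by simp
      smul_mem' := by
        rintro c t ⟨h₁, h₂⟩
        refine ⟨?_, ?_⟩
        · simp only [smul_eq_mul, QuadraticAlgebra.re_mul, h₁]
          linear_combination c.im * h₂
        · simp only [smul_eq_mul, QuadraticAlgebra.im_mul, h₁]
          linear_combination c.re * h₂ }
  refine ⟨_ ⧸ I, inferInstance, (Ideal.Quotient.mk I).comp (algebraMap B _),
    Ideal.Quotient.mk I ⟨0, 1⟩, fun n v hv i => ?_, ?_,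
    isIntegral_mk_comp _ Algebra.IsIntegral.isIntegral I, ?_⟩
  · choose w hw using fun j => Ideal.Quotient.mk_surjective (v j)
    have hmem : ∑ j, w j ^ 2 ∈ I := by
      rw [← Ideal.Quotient.eq_zero_iff_mem, ← hv]
      simp [hw]
    let re : QuadraticAlgebra B b 0 →+ B := ⟨⟨QuadraticAlgebra.re, rfl⟩, fun _ _ => rfl⟩
    have hre : ∑ j, (w j).re ^ 2 + b * ∑ j, (w j).im ^ 2 = 0 := by
      have h0 : re (∑ j, w j ^ 2) = 0 := hmem.1
      rw [map_sum] at h0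
      refine Eq.trans ?_ h0
      rw [Finset.mul_sum, ← Finset.sum_add_distrib]
      refine Finset.sum_congr rfl fun j _ => ?_
      change _ = (w j ^ 2).re
      rw [sq (w j), QuadraticAlgebra.re_mul]
      ring
    have hzero : ∑ j, (w j).re ^ 2 = 0 := by
      refine hQ.2.2.2 _ (hQ.sum_sq_mem _ _) ?_
      rw [neg_eq_of_add_eq_zero_right hre]
      exact hQ.2.1 _ hb _ (hQ.sum_sq_mem _ _)
    rw [hzero, zero_add] at hre
    rw [← hw i, Ideal.Quotient.eq_zero_iff_mem]
    refine ⟨hreal n _ hzero i, hreal n (fun j => b * (w j).im) ?_ i⟩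
    simp only [mul_pow, ← Finset.mul_sum]
    linear_combination b * hre
  · exact (injective_iff_map_eq_zero _).2 fun a ha => (Ideal.Quotient.eq_zero_iff_mem.1 ha).1
  · rw [← map_pow]
    refine congrArg (Ideal.Quotient.mk I) ?_
    ext <;> simp [sq]

/-- The only partial ordering of a von Neumann regular real closed * ring is its set of squares. -/
theorem IsRealClosedStar.mem_iff_exists_sq {B : Type u} [CommRing B] {Q : Set B}
    (hB : IsRealClosedStar B) (hvnr : IsVonNeumannRegular B) (hQ : IsPartialOrdering Q) (b : B) :
    b ∈ Q ↔ ∃ t, b = t ^ 2 := by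
  refine ⟨fun hb => ?_, fun ⟨t, ht⟩ => ht ▸ hQ.2.2.1 t⟩
  obtain ⟨D, _, h, s, hD, hinj, hint, hs⟩ := hQ.exists_real_integral_sqrt hB.1 hb
  obtain ⟨J, hJ⟩ := exists_ideal_isEssentialExtension h hinj
  have := hD.isReduced
  have hDJ := hD.quotient (hvnr.of_isIntegral h hint) J
  obtain ⟨hi, hsurj⟩ := hB.bijective_of_comp hDJ (RingHom.id B) ((Ideal.Quotient.mk J).comp h)
    (isEssentialExtension_id B) hJ (isIntegral_mk_comp h hint J)
  obtain ⟨t, ht⟩ := hsurj (Ideal.Quotient.mk J s)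
  exact ⟨t, hi (by rw [map_pow, ht, ← map_pow, hs, RingHom.comp_apply])⟩

/-- Let `(A, P)` be a real von Neumann regular poring and let
`(B, QB, f)` and `(C, QC, g)` be two real closures * of `A`.  Then `B` and `C` are
`A`-isomorphic (as porings) iff for every `x ∈ Spec A` there are `y ∈ Spec B` and
`z ∈ Spec C` lying over `x` such that the real closed fields `B / y` and `C / z` are
`A/x`-isomorphic. -/
theorem realClosureStar_aIso_iff_residue_isomorphisms
    (A : Type u) [CommRing A] (P : Set A) (hP : IsPartialOrdering P)
    (hreal : IsRealRing A) (hvnr : IsVonNeumannRegular A)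
    (B : Type u) [CommRing B] (QB : Set B) (f : A →+* B)
    (C : Type u) [CommRing C] (QC : Set C) (g : A →+* C)
    (hB : IsRealClosureStarOf A P B QB f) (hC : IsRealClosureStarOf A P C QC g) :
    (∃ e : B ≃+* C, (∀ a : A, e (f a) = g a) ∧ ∀ b : B, b ∈ QB ↔ e b ∈ QC) ↔
      ∀ x : PrimeSpectrum A, ∃ (y : PrimeSpectrum B) (z : PrimeSpectrum C),
        y.asIdeal.comap f = x.asIdeal ∧ z.asIdeal.comap g = x.asIdeal ∧
        ∃ e : B ⧸ y.asIdeal ≃+* C ⧸ z.asIdeal,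
          ∀ a : A, e (Ideal.Quotient.mk y.asIdeal (f a)) =
            Ideal.Quotient.mk z.asIdeal (g a) := by
  have := hB.rcs.1.isReduced
  have := hC.rcs.1.isReduced
  have hBv : IsVonNeumannRegular B := hvnr.of_isIntegral f hB.integral
  have hCv : IsVonNeumannRegular C := hvnr.of_isIntegral g hC.integral
  constructor
  · rintro ⟨e, he, -⟩ x
    obtain ⟨y, hy⟩ := hB.integral.comap_surjective hB.essential.1 x
    have hyx : y.asIdeal.comap f = x.asIdeal := congrArg PrimeSpectrum.asIdeal hy
    have hcomp : (e.symm : C →+* B).comp g = f := by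
      ext a
      simp [← he]
    refine ⟨y, PrimeSpectrum.comap (e.symm : C →+* B) y, hyx, ?_,
      Ideal.quotientEquiv _ _ e ?_, fun a => ?_⟩
    · rw [PrimeSpectrum.comap_asIdeal, Ideal.comap_comap, hcomp, hyx]
    · exact (Ideal.map_comap_of_equiv e).symm
    · exact congrArg (Ideal.Quotient.mk _) (he a)
  · intro H
    choose y z hy hz e he using H
    have := hreal.isReduced
    let φ : B →+* ∀ x, C ⧸ (z x).asIdeal :=
      RingHom.pi fun x => ((e x : _ →+* _)).comp (Ideal.Quotient.mk (y x).asIdeal)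
    let ψ : C →+* ∀ x, C ⧸ (z x).asIdeal := RingHom.pi fun x => Ideal.Quotient.mk (z x).asIdeal
    have hφψ : φ.comp f = ψ.comp g := by
      ext a x
      exact he x a
    have hinj : Function.Injective (ψ.comp g) := by
      refine (injective_iff_map_eq_zero _).2 fun a ha => IsNilpotent.eq_zero ?_
      refine nilpotent_iff_mem_prime.2 fun p hp => ?_
      have hap : Ideal.Quotient.mk (z ⟨p, hp⟩).asIdeal (g a) = 0 := congrFun ha ⟨p, hp⟩
      rw [Ideal.Quotient.eq_zero_iff_mem, ← Ideal.mem_comap, hz] at hap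
      exact hap
    let : Algebra A (∀ x, C ⧸ (z x).asIdeal) := (ψ.comp g).toAlgebra
    let D := integralClosure A (∀ x, C ⧸ (z x).asIdeal)
    have hφ : ∀ b, φ b ∈ D := fun b => by
      have : (ψ.comp g).IsIntegralElem (φ b) := by
        rw [← hφψ]
        exact (hB.integral b).map φ
      exact this
    have hψ : ∀ c, ψ c ∈ D := fun c => (hC.integral c).map ψ
    let φD : B →+* D := φ.codRestrict D hφ
    let ψD : C →+* D := ψ.codRestrict D hψ
    have hφf : φD.comp f = algebraMap A D := by
      ext a : 2
      exact RingHom.congr_fun hφψ a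
    have hψg : ψD.comp g = algebraMap A D := rfl
    have hDint : (algebraMap A D).IsIntegral := Algebra.IsIntegral.isIntegral
    have hDinj : Function.Injective (algebraMap A D) := fun a b hab =>
      hinj (congrArg Subtype.val hab)
    have hDreal : IsRealRing D := isRealRing_of_injective D.val.toRingHom Subtype.val_injective
      (IsRealRing.pi fun x => hC.rcs.1.quotient hCv _)
    have := hDreal.isReduced
    obtain ⟨J, hJ⟩ := exists_ideal_isEssentialExtension _ hDinj
    have hDJ := hDreal.quotient (hvnr.of_isIntegral _ hDint) J
    have hJint := isIntegral_mk_comp _ hDint J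
    have hbij₁ := hB.rcs.bijective_of_comp hDJ f ((Ideal.Quotient.mk J).comp φD) hB.essential
      (by rwa [RingHom.comp_assoc, hφf]) (by rwa [RingHom.comp_assoc, hφf])
    have hbij₂ := hC.rcs.bijective_of_comp hDJ g ((Ideal.Quotient.mk J).comp ψD) hC.essential
      (by rwa [RingHom.comp_assoc, hψg]) (by rwa [RingHom.comp_assoc, hψg])
    let E : B ≃+* C := (RingEquiv.ofBijective _ hbij₁).trans (RingEquiv.ofBijective _ hbij₂).symm
    refine ⟨E, fun a => ?_, fun b => ?_⟩
    · exact (RingEquiv.symm_apply_eq (RingEquiv.ofBijective _ hbij₂)).2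
        (congrArg (Ideal.Quotient.mk J) (RingHom.congr_fun (hφf.trans hψg.symm) a))
    · rw [hB.rcs.mem_iff_exists_sq hBv hB.pos_partial, hC.rcs.mem_iff_exists_sq hCv hC.pos_partial]
      constructor
      · rintro ⟨t, rfl⟩
        exact ⟨E t, map_pow E t 2⟩
      · rintro ⟨t, ht⟩
        exact ⟨E.symm t, E.injective (by rw [ht, map_pow, E.apply_symm_apply])⟩
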